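/- If an ABox in HPDL is satisfiable, then it has a finitely branching Kripke model, i.e., a model M in which, for every state x ∈ Δ^M and every atomic program σ, the set {y ∈ Δ^M : (x,y) ∈ σ^M} is finite. -/

import Mathlib

set_option maxHeartbeats 1000000

/-! ## Syntax of HPDL (base language) -/

/-- Nominals. -/
abbrev Nom := ℕ
/-- Propositions. -/
abbrev Prp := ℕ
/-- Atomic programs. -/
abbrev APg := ℕ

mutual
/-- Formulas of the base language of HPDL. -/
inductive Fm : Type where
  | top | bot
  | prp (p : Prp) | nom (a : Nom)
  | neg (φ : Fm) | land (φ ψ : Fm) | lor (φ ψ : Fm) | imp (φ ψ : Fm)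
  | dia (α : Pg) (φ : Fm) | box (α : Pg) (φ : Fm)
/-- Programs of HPDL. -/
inductive Pg : Type where
  | atom (σ : APg) | seq (α β : Pg) | choice (α β : Pg) | star (α : Pg) | test (φ : Fm)
end

noncomputable instance : DecidableEq Fm := Classical.decEq _
noncomputable instance : DecidableEq Pg := Classical.decEq _

/-! ## Kripke semantics -/

/-- A Kripke model for HPDL. -/
structure Kripke where
  W : Type
  nomI : Nom → W
  prpI : Prp → Set W
  progI : APg → Set (W × W)

mutual
/-- Interpretation of formulas. -/
def Fm.sem (M : Kripke) : Fm → Set M.W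
  | .top => Set.univ
  | .bot => ∅
  | .prp p => M.prpI p
  | .nom a => {M.nomI a}
  | .neg φ => (Fm.sem M φ)ᶜ
  | .land φ ψ => Fm.sem M φ ∩ Fm.sem M ψ
  | .lor φ ψ => Fm.sem M φ ∪ Fm.sem M ψ
  | .imp φ ψ => (Fm.sem M φ)ᶜ ∪ Fm.sem M ψ
  | .dia α φ => {x | ∃ y, (x, y) ∈ Pg.sem M α ∧ y ∈ Fm.sem M φ}
  | .box α φ => {x | ∀ y, (x, y) ∈ Pg.sem M α → y ∈ Fm.sem M φ}
/-- Interpretation of programs. -/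
def Pg.sem (M : Kripke) : Pg → Set (M.W × M.W)
  | .atom σ => M.progI σ
  | .seq α β => {p | ∃ z, (p.1, z) ∈ Pg.sem M α ∧ (z, p.2) ∈ Pg.sem M β}
  | .choice α β => Pg.sem M α ∪ Pg.sem M β
  | .star α => {p | Relation.ReflTransGen (fun x y => (x, y) ∈ Pg.sem M α) p.1 p.2}
  | .test φ => {p | p.1 = p.2 ∧ p.1 ∈ Fm.sem M φ}
end

/-! ## Assertions and ABoxes -/

/-- An assertion is `a:φ` or `σ(a,b)`. -/
inductive Assertion : Type where
  | mem (a : Nom) (φ : Fm)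
  | rel (σ : APg) (a b : Nom)

noncomputable instance : DecidableEq Assertion := Classical.decEq _

/-- `M ⊨ ξ` for an assertion `ξ`. -/
def Kripke.satisfies (M : Kripke) : Assertion → Prop
  | .mem a φ => M.nomI a ∈ Fm.sem M φ
  | .rel σ a b => (M.nomI a, M.nomI b) ∈ M.progI σ

/-- An ABox (finite set of assertions) is satisfiable if some Kripke model
satisfies all its assertions. -/
def ABoxSat (Γ : Finset Assertion) : Prop :=
  ∃ M : Kripke, ∀ ξ ∈ Γ, M.satisfies ξ

/-! ## Negation normal form and length -/

mutual
/-- A formula is in NNF iff it does not use `→` and uses `¬` only immediately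
before propositions or nominals. -/
def Fm.isNNF : Fm → Prop
  | .top => True
  | .bot => True
  | .prp _ => True
  | .nom _ => True
  | .neg (.prp _) => True
  | .neg (.nom _) => True
  | .neg _ => False
  | .land φ ψ => φ.isNNF ∧ ψ.isNNF
  | .lor φ ψ => φ.isNNF ∧ ψ.isNNF
  | .imp _ _ => False
  | .dia α φ => α.isNNF ∧ φ.isNNF
  | .box α φ => α.isNNF ∧ φ.isNNF
def Pg.isNNF : Pg → Prop
  | .atom _ => True
  | .seq α β => α.isNNF ∧ β.isNNF
  | .choice α β => α.isNNF ∧ β.isNNF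
  | .star α => α.isNNF
  | .test φ => φ.isNNF
end

mutual
/-- The length (number of symbol occurrences) of a formula. -/
def Fm.len : Fm → ℕ
  | .top => 1 | .bot => 1 | .prp _ => 1 | .nom _ => 1
  | .neg φ => 1 + φ.len
  | .land φ ψ => 1 + φ.len + ψ.len
  | .lor φ ψ => 1 + φ.len + ψ.len
  | .imp φ ψ => 1 + φ.len + ψ.len
  | .dia α φ => 1 + α.len + φ.len
  | .box α φ => 1 + α.len + φ.len
/-- The length (number of symbol occurrences) of a program. -/
def Pg.len : Pg → ℕ
  | .atom _ => 1
  | .seq α β => 1 + α.len + β.len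
  | .choice α β => 1 + α.len + β.len
  | .star α => 1 + α.len
  | .test φ => 1 + φ.len
end

/-- The length of an assertion. -/
def Assertion.len : Assertion → ℕ
  | .mem _ φ => 2 + φ.len
  | .rel _ _ _ => 3

/-- An assertion in NNF. -/
def Assertion.isNNF : Assertion → Prop
  | .mem _ φ => φ.isNNF
  | .rel _ _ _ => True

/-- An ABox in NNF. -/
def ABoxInNNF (Γ : Finset Assertion) : Prop := ∀ ξ ∈ Γ, ξ.isNNF

/-- The size of an ABox: the sum of the lengths of its assertions. -/
def aboxSize (Γ : Finset Assertion) : ℕ := ∑ ξ ∈ Γ, ξ.len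

/-- The NNF of the negation of a formula (assuming the input is in NNF). -/
def Fm.nnfNeg : Fm → Fm
  | .top => .bot
  | .bot => .top
  | .prp p => .neg (.prp p)
  | .nom a => .neg (.nom a)
  | .neg φ => φ
  | .land φ ψ => .lor φ.nnfNeg ψ.nnfNeg
  | .lor φ ψ => .land φ.nnfNeg ψ.nnfNeg
  | .imp φ ψ => .land φ ψ.nnfNeg
  | .dia α φ => .box α φ.nnfNeg
  | .box α φ => .dia α φ.nnfNeg
/-! ## Automata over alphabets of atomic programs and tests -/

/-- A letter of the alphabet `Σ(α)` of a program: an atomic program or a test. -/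
inductive Lab : Type where
  | atom (σ : APg) | test (φ : Fm)

/-- A letter viewed as a program. -/
def Lab.toPg : Lab → Pg
  | .atom σ => .atom σ
  | .test φ => .test φ

/-- A finite automaton over an alphabet of atomic programs and tests.
(`states`, `init`, `accept` are finite sets of natural numbers.) -/
structure Aut : Type where
  states : Finset ℕ
  init : Finset ℕ
  trans : ℕ → Lab → ℕ → Prop
  accept : Finset ℕ

/-- `AutAccepts A q w` : the automaton `A`, started at state `q`, accepts the
word `w` (i.e. `(A,q)` accepts `w`). -/
inductive AutAccepts (A : Aut) : ℕ → List Lab → Prop where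
  | nil {q : ℕ} : q ∈ A.accept → AutAccepts A q []
  | cons {q : ℕ} {ω : Lab} {q' : ℕ} {w : List Lab} :
      A.trans q ω q' → AutAccepts A q' w → AutAccepts A q (ω :: w)

/-- The language accepted by the automaton `A` (from its initial states). -/
def AutLang (A : Aut) (w : List Lab) : Prop := ∃ q ∈ A.init, AutAccepts A q w

/-- The alphabet `Σ(α)` of a program. -/
def Pg.alphabet : Pg → Set Lab
  | .atom σ => {.atom σ}
  | .test φ => {.test φ}
  | .seq α β => α.alphabet ∪ β.alphabet
  | .choice α β => α.alphabet ∪ β.alphabet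
  | .star α => α.alphabet

/-- The regular language `L(α)` generated by a program `α` viewed as a regular
expression over `Σ(α)`. -/
def Pg.lang : Pg → Set (List Lab)
  | .atom σ => {[.atom σ]}
  | .test φ => {[.test φ]}
  | .seq α β => {w | ∃ u ∈ α.lang, ∃ v ∈ β.lang, w = u ++ v}
  | .choice α β => α.lang ∪ β.lang
  | .star α => {w | ∃ l : List (List Lab), (∀ u ∈ l, u ∈ α.lang) ∧ w = l.flatten}

/-- The interpretation of a letter (as a program). -/
def Lab.sem (M : Kripke) : Lab → Set (M.W × M.W)
  | .atom σ => M.progI σ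
  | .test φ => {p | p.1 = p.2 ∧ p.1 ∈ Fm.sem M φ}

/-- The interpretation of a word `ω₁…ω_k`, treated as the program `ω₁;…;ω_k`
(the empty word denotes the identity program). -/
def wordSem (M : Kripke) : List Lab → Set (M.W × M.W)
  | [] => {p | p.1 = p.2}
  | ω :: w => {p | ∃ z, (p.1, z) ∈ Lab.sem M ω ∧ (z, p.2) ∈ wordSem M w}

/-! ## The extended language of HPDL (with automaton-modal operators) -/

/-- Formulas of the extended language of HPDL, admitting the automaton-modal
operators `[A,q]` and `⟨A,q⟩`. -/
inductive EFm : Type where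
  | top | bot
  | prp (p : Prp) | nom (a : Nom)
  | neg (φ : EFm) | land (φ ψ : EFm) | lor (φ ψ : EFm) | imp (φ ψ : EFm)
  | dia (α : Pg) (φ : EFm) | box (α : Pg) (φ : EFm)
  | diaA (A : Aut) (q : ℕ) (φ : EFm) | boxA (A : Aut) (q : ℕ) (φ : EFm)

/-- Interpretation of extended formulas, where `(⟨A,q⟩φ)^M` and `([A,q]φ)^M`
are interpreted via the program `(A,q)` with `A^M = ⋃ {γ^M : γ ∈ L(A)}`. -/
def EFm.sem (M : Kripke) : EFm → Set M.W
  | .top => Set.univ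
  | .bot => ∅
  | .prp p => M.prpI p
  | .nom a => {M.nomI a}
  | .neg φ => (EFm.sem M φ)ᶜ
  | .land φ ψ => EFm.sem M φ ∩ EFm.sem M ψ
  | .lor φ ψ => EFm.sem M φ ∪ EFm.sem M ψ
  | .imp φ ψ => (EFm.sem M φ)ᶜ ∪ EFm.sem M ψ
  | .dia α φ => {x | ∃ y, (x, y) ∈ Pg.sem M α ∧ y ∈ EFm.sem M φ}
  | .box α φ => {x | ∀ y, (x, y) ∈ Pg.sem M α → y ∈ EFm.sem M φ}
  | .diaA A q φ => {x | ∃ w, AutAccepts A q w ∧ ∃ y, (x, y) ∈ wordSem M w ∧ y ∈ EFm.sem M φ}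
  | .boxA A q φ => {x | ∀ w, AutAccepts A q w → ∀ y, (x, y) ∈ wordSem M w → y ∈ EFm.sem M φ}

/-- Embedding of base formulas into the extended language. -/
def Fm.toE : Fm → EFm
  | .top => .top | .bot => .bot | .prp p => .prp p | .nom a => .nom a
  | .neg φ => .neg φ.toE
  | .land φ ψ => .land φ.toE ψ.toE
  | .lor φ ψ => .lor φ.toE ψ.toE
  | .imp φ ψ => .imp φ.toE ψ.toE
  | .dia α φ => .dia α φ.toE
  | .box α φ => .box α φ.toE

/-- The NNF of the negation of an extended formula (for formulas in NNF). -/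
def EFm.nnfNeg : EFm → EFm
  | .top => .bot
  | .bot => .top
  | .prp p => .neg (.prp p)
  | .nom a => .neg (.nom a)
  | .neg φ => φ
  | .land φ ψ => .lor φ.nnfNeg ψ.nnfNeg
  | .lor φ ψ => .land φ.nnfNeg ψ.nnfNeg
  | .imp φ ψ => .land φ ψ.nnfNeg
  | .dia α φ => .box α φ.nnfNeg
  | .box α φ => .dia α φ.nnfNeg
  | .diaA A q φ => .boxA A q φ.nnfNeg
  | .boxA A q φ => .diaA A q φ.nnfNeg
/-! ## Items: formulas and assertions of the extended language -/

/-- An item is a formula, an assertion `a:φ`, or an assertion `σ(a,b)`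
(in the extended language). -/
inductive Item : Type where
  | fm (φ : EFm)
  | mem (a : Nom) (φ : EFm)
  | rel (σ : APg) (a b : Nom)

/-- A base assertion as an item. -/
def Assertion.toItem : Assertion → Item
  | .mem a φ => .mem a φ.toE
  | .rel σ a b => .rel σ a b

def Item.isFormula : Item → Prop
  | .fm _ => True
  | _ => False

def Item.isAssertion : Item → Prop
  | .fm _ => False
  | _ => True

/-- Satisfaction of an item in a Kripke model (a formula is satisfied iff its
interpretation is nonempty). -/
def Kripke.satItem (M : Kripke) : Item → Prop
  | .fm φ => (EFm.sem M φ).Nonempty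
  | .mem a φ => M.nomI a ∈ EFm.sem M φ
  | .rel σ a b => (M.nomI a, M.nomI b) ∈ M.progI σ

/-! ## Subformulas, occurrences of nominals, replacement of nominals -/

mutual
/-- `Subf φ ψ` : `φ` is a subformula of `ψ`. -/
inductive Subf : Fm → Fm → Prop where
  | refl (φ : Fm) : Subf φ φ
  | neg {φ ψ : Fm} : Subf φ ψ → Subf φ (.neg ψ)
  | andl {φ ψ₁ ψ₂ : Fm} : Subf φ ψ₁ → Subf φ (.land ψ₁ ψ₂)
  | andr {φ ψ₂ ψ₁ : Fm} : Subf φ ψ₂ → Subf φ (.land ψ₁ ψ₂)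
  | orl {φ ψ₁ ψ₂ : Fm} : Subf φ ψ₁ → Subf φ (.lor ψ₁ ψ₂)
  | orr {φ ψ₂ ψ₁ : Fm} : Subf φ ψ₂ → Subf φ (.lor ψ₁ ψ₂)
  | impl {φ ψ₁ ψ₂ : Fm} : Subf φ ψ₁ → Subf φ (.imp ψ₁ ψ₂)
  | impr {φ ψ₂ ψ₁ : Fm} : Subf φ ψ₂ → Subf φ (.imp ψ₁ ψ₂)
  | diaf {φ ψ : Fm} {α : Pg} : Subf φ ψ → Subf φ (.dia α ψ)
  | diap {φ : Fm} {α : Pg} {ψ : Fm} : SubfP φ α → Subf φ (.dia α ψ)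
  | boxf {φ ψ : Fm} {α : Pg} : Subf φ ψ → Subf φ (.box α ψ)
  | boxp {φ : Fm} {α : Pg} {ψ : Fm} : SubfP φ α → Subf φ (.box α ψ)
/-- `SubfP φ α` : `φ` is a subformula of the program `α` (inside a test). -/
inductive SubfP : Fm → Pg → Prop where
  | test {φ ψ : Fm} : Subf φ ψ → SubfP φ (.test ψ)
  | seql {φ : Fm} {α β : Pg} : SubfP φ α → SubfP φ (.seq α β)
  | seqr {φ : Fm} {β α : Pg} : SubfP φ β → SubfP φ (.seq α β)
  | chl {φ : Fm} {α β : Pg} : SubfP φ α → SubfP φ (.choice α β)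
  | chr {φ : Fm} {β α : Pg} : SubfP φ β → SubfP φ (.choice α β)
  | star {φ : Fm} {α : Pg} : SubfP φ α → SubfP φ (.star α)
end

/-- `bsf Γ` : all subformulas of `Γ` together with their negations in NNF. -/
def bsf (Γ : Finset Assertion) : Set Fm :=
  {φ | ∃ ξ ∈ Γ, ∃ a ψ, ξ = Assertion.mem a ψ ∧ Subf φ ψ} ∪
  {φ | ∃ ξ ∈ Γ, ∃ a ψ χ, ξ = Assertion.mem a ψ ∧ Subf χ ψ ∧ φ = χ.nnfNeg}

/-- The nominal `a` occurs in the ABox `Γ`. -/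
def NomOccurs (a : Nom) (Γ : Finset Assertion) : Prop :=
  ∃ ξ ∈ Γ, (match ξ with
    | .mem b φ => a = b ∨ Subf (.nom a) φ
    | .rel _ b c => a = b ∨ a = c)

mutual
/-- Replace every occurrence of the nominal `b` by `a` in a base formula. -/
def Fm.replNom (b a : Nom) : Fm → Fm
  | .top => .top | .bot => .bot | .prp p => .prp p
  | .nom c => if c = b then .nom a else .nom c
  | .neg φ => .neg (φ.replNom b a)
  | .land φ ψ => .land (φ.replNom b a) (ψ.replNom b a)
  | .lor φ ψ => .lor (φ.replNom b a) (ψ.replNom b a)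
  | .imp φ ψ => .imp (φ.replNom b a) (ψ.replNom b a)
  | .dia α φ => .dia (α.replNom b a) (φ.replNom b a)
  | .box α φ => .box (α.replNom b a) (φ.replNom b a)
/-- Replace every occurrence of the nominal `b` by `a` in a program. -/
def Pg.replNom (b a : Nom) : Pg → Pg
  | .atom σ => .atom σ
  | .seq α β => .seq (α.replNom b a) (β.replNom b a)
  | .choice α β => .choice (α.replNom b a) (β.replNom b a)
  | .star α => .star (α.replNom b a)
  | .test φ => .test (φ.replNom b a)
end

/-- Replace `b` by `a` in a letter. -/
def Lab.replNom (b a : Nom) : Lab → Lab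
  | .atom σ => .atom σ
  | .test φ => .test (φ.replNom b a)

/-- Replace `b` by `a` inside an automaton (i.e. in the tests of its alphabet). -/
def Aut.replNom (b a : Nom) (A : Aut) : Aut :=
  { states := A.states, init := A.init, accept := A.accept,
    trans := fun q ω q' => ∃ ω₀, A.trans q ω₀ q' ∧ ω = ω₀.replNom b a }

/-- Replace `b` by `a` in an extended formula (including inside automata of
modal operators). -/
def EFm.replNom (b a : Nom) : EFm → EFm
  | .top => .top | .bot => .bot | .prp p => .prp p
  | .nom c => if c = b then .nom a else .nom c
  | .neg φ => .neg (φ.replNom b a)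
  | .land φ ψ => .land (φ.replNom b a) (ψ.replNom b a)
  | .lor φ ψ => .lor (φ.replNom b a) (ψ.replNom b a)
  | .imp φ ψ => .imp (φ.replNom b a) (ψ.replNom b a)
  | .dia α φ => .dia (α.replNom b a) (φ.replNom b a)
  | .box α φ => .box (α.replNom b a) (φ.replNom b a)
  | .diaA A q φ => .diaA (A.replNom b a) q (φ.replNom b a)
  | .boxA A q φ => .boxA (A.replNom b a) q (φ.replNom b a)

/-- Replace `b` by `a` in an item. -/
def Item.replNom (b a : Nom) : Item → Item
  | .fm φ => .fm (φ.replNom b a)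
  | .mem c φ => .mem (if c = b then a else c) (φ.replNom b a)
  | .rel σ c d => .rel σ (if c = b then a else c) (if d = b then a else d)

/-! ## The closures `cls_Z(Γ)` and `cls(Γ)` -/

/-- `cls_Z(Γ)`, parametrized by the chosen automata `aut α = Aut_α`. -/
inductive ClsZ (aut : Pg → Aut) (Γ : Finset Assertion) : Item → Prop where
  | ofGamma {ξ : Assertion} : ξ ∈ Γ → ClsZ aut Γ ξ.toItem
  | ofBsf {φ : Fm} : φ ∈ bsf Γ → ClsZ aut Γ (.fm φ.toE)
  | boxAut {α : Pg} {φ : Fm} {q : ℕ} :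
      (Fm.box α φ) ∈ bsf Γ → q ∈ (aut α).states →
      ClsZ aut Γ (.fm (.boxA (aut α) q φ.toE))
  | boxAutStep {α : Pg} {φ : Fm} {q : ℕ} {ω : Lab} :
      (Fm.box α φ) ∈ bsf Γ → q ∈ (aut α).states → ω ∈ α.alphabet →
      ClsZ aut Γ (.fm (.box ω.toPg (.boxA (aut α) q φ.toE)))
  | diaAut {α : Pg} {φ : Fm} {q : ℕ} :
      (Fm.dia α φ) ∈ bsf Γ → q ∈ (aut α).states →
      ClsZ aut Γ (.fm (.diaA (aut α) q φ.toE))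
  | diaAutStep {α : Pg} {φ : Fm} {q : ℕ} {ω : Lab} :
      (Fm.dia α φ) ∈ bsf Γ → q ∈ (aut α).states → ω ∈ α.alphabet →
      ClsZ aut Γ (.fm (.dia ω.toPg (.diaA (aut α) q φ.toE)))
  | nomi {φ : EFm} {a : Nom} :
      ClsZ aut Γ (.fm φ) → NomOccurs a Γ → ClsZ aut Γ (.mem a φ)

/-- `cls(Γ)` : the closure of `cls_Z(Γ)` under replacement of nominals
occurring in `Γ`. -/
inductive Cls (aut : Pg → Aut) (Γ : Finset Assertion) : Item → Prop where
  | base {ξ : Item} : ClsZ aut Γ ξ → Cls aut Γ ξ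
  | repl {ξ : Item} {a b : Nom} :
      Cls aut Γ ξ → NomOccurs a Γ → NomOccurs b Γ →
      Cls aut Γ (ξ.replNom b a)
/-! ## Tableaux of the calculus C_HPDL -/

inductive NType : Type where | state | nonState
deriving DecidableEq

inductive SType : Type where | complex | simple
deriving DecidableEq

/-- Statuses of tableau nodes. -/
inductive Status (V : Type) : Type where
  | unexpanded | expanded | incomplete | blocked | unsat
  | unsatWrt (U : Set V)

/-- The data structure of a tableau: a rooted graph whose nodes carry the
attributes Type, SType, Label, RFormulas, Status, AssSN and Repl, and whose
edges leaving states are labeled by sets of items. -/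
structure Tableau where
  V : Type
  vfin : Finite V
  E : V → V → Prop
  root : V
  ntype : V → NType
  stype : V → SType
  label : V → Set Item
  rformulas : V → Set Item
  status : V → Status V
  assSN : V → Set Item
  repl : V → Nom → Option Nom
  elabels : V → V → Set Item

/-- `FullLabel(v)`. -/
def Tableau.fullLabel (G : Tableau) (v : G.V) : Set Item :=
  G.label v ∪ G.rformulas v ∪
    {i | G.stype v = SType.complex ∧ ∃ a b, G.repl v b = some a ∧ i = Item.mem a (.nom b)}

/-- `v` is a complex state. -/
def Tableau.isComplexState (G : Tableau) (v : G.V) : Prop :=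
  G.stype v = SType.complex ∧ G.ntype v = NType.state

/-- `Status(v) ∉ {unsat} ∪ {unsat-wrt(U) : u ∈ U}`. -/
def Tableau.statusOkWrt (G : Tableau) (u v : G.V) : Prop :=
  G.status v ≠ Status.unsat ∧ ∀ U : Set G.V, G.status v = Status.unsatWrt U → u ∉ U

/-- `v` is a descendant of `u` (reflexive-transitive closure of the successor
relation). -/
def Tableau.Descendant (G : Tableau) (u v : G.V) : Prop :=
  Relation.ReflTransGen G.E u v

/-- `G` is a C_HPDL-tableau for the ABox `Γ`.  This predicate abstracts the
tableau calculus C_HPDL of Section 3 of the paper "Tableaux with Global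
Caching for Hybrid PDL": it records the structural invariants of the
construction (the root is a complex non-state labeled with `Γ`, global caching,
finiteness of labels, complex nodes carry assertions while simple nodes carry
formulas, only states have labeled outgoing edges); the graph is assumed to be
built by exhaustively applying the static rules, the nominal-replacement rule,
the rule (nom), the re-expansion rule, the state-forming rule, the transitional
rule and the status-update rule (unsat) of the calculus. -/
structure IsCHPDLTableau (Γ : Finset Assertion) (G : Tableau) : Prop where
  root_ntype : G.ntype G.root = NType.nonState
  root_stype : G.stype G.root = SType.complex
  root_label : G.label G.root = Assertion.toItem '' (↑Γ : Set Assertion)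
  globalCaching : ∀ v w : G.V, G.ntype v = G.ntype w → G.stype v = G.stype w →
      G.label v = G.label w → G.rformulas v = G.rformulas w →
      G.repl v = G.repl w → v = w
  label_finite : ∀ v, (G.label v).Finite
  rformulas_finite : ∀ v, (G.rformulas v).Finite
  complex_assertions : ∀ v, G.stype v = SType.complex → ∀ i ∈ G.label v, i.isAssertion
  simple_formulas : ∀ v, G.stype v = SType.simple → ∀ i ∈ G.label v, i.isFormula
  repl_only_complex : ∀ v, G.stype v = SType.simple → ∀ a, G.repl v a = none
  elabels_states : ∀ v w : G.V, (∃ i, i ∈ G.elabels v w) → G.ntype v = NType.state ∧ G.E v w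

/-! ## ◇-realizability and ◇-realizations (Definitions 3 and 6 of the paper) -/

/-- `o:φ` where `o` is a nominal or nothing. -/
def mkO (o : Option Nom) (φ : EFm) : Item :=
  match o with
  | none => .fm φ
  | some a => .mem a φ

/-- Extended formulas of the form `⟨A,q⟩φ` or `⟨ω⟩⟨A,q⟩φ`. -/
def EFm.isDiaShape : EFm → Prop
  | .diaA _ _ _ => True
  | .dia (.atom _) (.diaA _ _ _) => True
  | .dia (.test _) (.diaA _ _ _) => True
  | _ => False

/-- Items of the form `o:⟨A,q⟩φ` or `o:⟨ω⟩⟨A,q⟩φ`. -/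
def Item.isDiaShape : Item → Prop
  | .fm φ => φ.isDiaShape
  | .mem _ φ => φ.isDiaShape
  | .rel _ _ _ => False

/-- One step of a ◇-realization w.r.t. the complex state `u` (the propagation
conditions (b), (c), (f)–(k) of Definition 3 of the paper). -/
inductive RealStep (G : Tableau) (u : G.V) : G.V × Item → G.V × Item → Prop where
  /-- condition (b): follow a `δ_A`-transition inside the full label. -/
  | delta {v : G.V} {o : Option Nom} {A : Aut} {q : ℕ} {ω : Lab} {q' : ℕ} {φ : EFm} :
      A.trans q ω q' →
      mkO o (.dia ω.toPg (.diaA A q' φ)) ∈ G.fullLabel v →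
      RealStep G u (v, mkO o (.diaA A q φ)) (v, mkO o (.dia ω.toPg (.diaA A q' φ)))
  /-- condition (c): decompose a test. -/
  | testStep {v : G.V} {o : Option Nom} {ψ : Fm} {A : Aut} {q : ℕ} {φ : EFm} :
      mkO o ψ.toE ∈ G.fullLabel v →
      mkO o (.diaA A q φ) ∈ G.fullLabel v →
      RealStep G u (v, mkO o (.dia (.test ψ) (.diaA A q φ))) (v, mkO o (.diaA A q φ))
  /-- conditions (f)–(h): pass to a successor carrying (the trace of) the item. -/
  | succ {v w : G.V} {ξ : Item} :
      G.E v w → ξ ∈ G.fullLabel w →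
      RealStep G u (v, ξ) (w, ξ)
  /-- condition (j): follow a transitional edge of a state. -/
  | transEdge {v w : G.V} {o : Option Nom} {σ : APg} {A : Aut} {q : ℕ} {φ : EFm} :
      G.ntype v = NType.state → G.E v w →
      mkO o (.dia (.atom σ) (.diaA A q φ)) ∈ G.elabels v w →
      Item.fm (.diaA A q φ) ∈ G.label w →
      RealStep G u (v, mkO o (.dia (.atom σ) (.diaA A q φ))) (w, Item.fm (.diaA A q φ))
  /-- condition (k): jump via a nominal in the label back to `u`. -/
  | nomJump {v : G.V} {a : Nom} {φ : EFm} :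
      Item.fm (.nom a) ∈ G.label v →
      Item.mem a φ ∈ G.fullLabel u →
      RealStep G u (v, Item.fm φ) (u, Item.mem a φ)

/-- The final step of a ◇-realization w.r.t. `u` (the base conditions (a) and
(e) of Definition 3 of the paper), producing `ξ_{k+1} = o:φ`. -/
inductive RealLast (G : Tableau) (u : G.V) : G.V × Item → G.V × Item → Prop where
  /-- condition (a): `q` is accepting and `o:φ` already belongs to the full label. -/
  | inLabel {v : G.V} {o : Option Nom} {A : Aut} {q : ℕ} {φ : EFm} :
      q ∈ A.accept → mkO o φ ∈ G.fullLabel v →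
      RealLast G u (v, mkO o (.diaA A q φ)) (v, mkO o φ)
  /-- condition (e): `q` is accepting and the successor obtained by replacing
  the principal item by `o:φ` does not have status unsat/unsat-wrt-`u`. -/
  | viaSucc {v w : G.V} {o : Option Nom} {A : Aut} {q : ℕ} {φ : EFm} :
      q ∈ A.accept → G.E v w → mkO o φ ∈ G.label w → G.statusOkWrt u w →
      RealLast G u (v, mkO o (.diaA A q φ)) (w, mkO o φ)

/-- A ◇-realization of `ξ` at `v` w.r.t. `u` (Definition 6 of the paper):
a finite sequence `(v_0,ξ_0), …, (v_{k+1},ξ_{k+1})` starting at `(v,ξ)`, whose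
consecutive pairs are related by the propagation conditions, ending with a base
condition, such that every intermediate item is of the form `o:⟨A,q⟩φ` or
`o:⟨ω⟩⟨A,q⟩φ`, belongs to the corresponding full label, and the status of every
intermediate node is neither unsat nor unsat-wrt a set containing `u`. -/
def DmdRealization (G : Tableau) (u v : G.V) (ξ : Item) : Prop :=
  ∃ (k : ℕ) (f : ℕ → G.V × Item),
    f 0 = (v, ξ) ∧
    (∀ i < k, RealStep G u (f i) (f (i + 1))) ∧
    RealLast G u (f k) (f (k + 1)) ∧
    (∀ i ≤ k, (f i).2 ∈ G.fullLabel (f i).1 ∧ (f i).2.isDiaShape ∧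
      G.statusOkWrt u (f i).1)

/-! ## Model graphs (Definition 7 of the paper) -/

/-- The data of a model graph of a tableau `G`: nodes are nominals or
(simple state) nodes of `G`. -/
structure ModelGraph (G : Tableau) where
  V' : Set (Nom ⊕ G.V)
  E' : (Nom ⊕ G.V) → (Nom ⊕ G.V) → Prop
  label' : (Nom ⊕ G.V) → Set EFm
  elabels' : (Nom ⊕ G.V) → (Nom ⊕ G.V) → Set APg

/-- `g` is a model graph of `G` w.r.t. the complex state `u` (Definition 7 of
the paper).  This predicate records the initialization of the construction and
the closure property achieved by its while-loop: nominal nodes are those `a`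
with `Repl(u)(a) = a`, labeled by the formulas `φ` with `a:φ ∈ FullLabel(u)`
together with `a`; edges between nominal nodes come from the assertions
`σ(a,b) ∈ Label(u)`; the remaining nodes are simple states of `G` whose status
is neither unsat nor unsat-wrt-`u`; and every formula `⟨σ⟩⟨A,q⟩ψ` in a label is
realized by a `σ`-labeled edge (obtained in the construction by following a
◇-realization together with a saturation path w.r.t. `u`). -/
structure IsModelGraphOf (G : Tableau) (u : G.V) (g : ModelGraph G) : Prop where
  nom_mem : ∀ a : Nom, G.repl u a = some a → Sum.inl a ∈ g.V'
  nom_only : ∀ a : Nom, Sum.inl a ∈ g.V' → G.repl u a = some a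
  nom_label : ∀ a : Nom, G.repl u a = some a →
      g.label' (Sum.inl a) = {φ | Item.mem a φ ∈ G.fullLabel u} ∪ {EFm.nom a}
  init_edge : ∀ (σ : APg) (a b : Nom), Item.rel σ a b ∈ G.label u →
      g.E' (Sum.inl a) (Sum.inl b) ∧ σ ∈ g.elabels' (Sum.inl a) (Sum.inl b)
  nodes_simple_states : ∀ w : G.V, Sum.inr w ∈ g.V' →
      G.ntype w = NType.state ∧ G.stype w = SType.simple ∧ G.statusOkWrt u w
  node_labels : ∀ w : G.V, Sum.inr w ∈ g.V' →
      ∃ v : G.V, G.ntype v = NType.nonState ∧ G.E v w ∧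
        {φ | Item.fm φ ∈ G.fullLabel v} ⊆ g.label' (Sum.inr w)
  edges_in : ∀ x y, g.E' x y → x ∈ g.V' ∧ y ∈ g.V'
  realized : ∀ x ∈ g.V', ∀ (σ : APg) (A : Aut) (q : ℕ) (ψ : EFm),
      EFm.dia (.atom σ) (.diaA A q ψ) ∈ g.label' x →
      ∃ y ∈ g.V', g.E' x y ∧ σ ∈ g.elabels' x y ∧ EFm.diaA A q ψ ∈ g.label' y
/-! ## STATEMENT 18: finitely branching models -/


namespace Filt

/-- Semantic diamond. -/
def Dia (M : Kripke) (α : Pg) (X : Set M.W) : Set M.W := {x | ∃ y, (x, y) ∈ Pg.sem M α ∧ y ∈ X}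

mutual
/-- Semantic Fischer-Ladner closure of a formula. -/
def C (M : Kripke) : Fm → Set (Set M.W)
  | .top => ∅
  | .bot => ∅
  | .prp p => {M.prpI p}
  | .nom a => {{M.nomI a}}
  | .neg φ => C M φ
  | .land φ ψ => C M φ ∪ C M ψ
  | .lor φ ψ => C M φ ∪ C M ψ
  | .imp φ ψ => C M φ ∪ C M ψ
  | .dia α φ => C M φ ∪ P M α (Fm.sem M φ)
  | .box α φ => C M φ ∪ P M α (Fm.sem M φ)ᶜ
/-- Semantic Fischer-Ladner closure of a diamond over `X`. -/
def P (M : Kripke) : Pg → Set M.W → Set (Set M.W)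
  | .atom σ, X => {Dia M (.atom σ) X}
  | .seq α β, X => P M α (Dia M β X) ∪ P M β X
  | .choice α β, X => P M α X ∪ P M β X
  | .star α, X => {Dia M (.star α) X} ∪ P M α (Dia M (.star α) X)
  | .test φ, _ => C M φ
end

mutual
theorem C_finite (M : Kripke) : ∀ φ : Fm, (C M φ).Finite
  | .top => by simp [C]
  | .bot => by simp [C]
  | .prp p => by simp [C]
  | .nom a => by simp [C]
  | .neg φ => by simpa [C] using C_finite M φ
  | .land φ ψ => by simpa [C] using ⟨C_finite M φ, C_finite M ψ⟩
  | .lor φ ψ => by simpa [C] using ⟨C_finite M φ, C_finite M ψ⟩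
  | .imp φ ψ => by simpa [C] using ⟨C_finite M φ, C_finite M ψ⟩
  | .dia α φ => by rw [C]; exact (C_finite M φ).union (P_finite M α _)
  | .box α φ => by rw [C]; exact (C_finite M φ).union (P_finite M α _)
theorem P_finite (M : Kripke) : ∀ (α : Pg) (X : Set M.W), (P M α X).Finite
  | .atom σ, X => by simp [P]
  | .seq α β, X => by rw [P]; exact (P_finite M α _).union (P_finite M β _)
  | .choice α β, X => by rw [P]; exact (P_finite M α _).union (P_finite M β _)
  | .star α, X => by rw [P]; exact (Set.finite_singleton _).union (P_finite M α _)
  | .test φ, _ => by rw [P]; exact C_finite M φ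
end

/-- Indistinguishability by a family of sets. -/
def std (M : Kripke) (S : Set (Set M.W)) : Setoid M.W where
  r x y := ∀ s ∈ S, x ∈ s ↔ y ∈ s
  iseqv := ⟨fun _ _ _ => Iff.rfl, fun h s hs => (h s hs).symm,
    fun h k s hs => (h s hs).trans (k s hs)⟩

/-- The minimal filtration. -/
def filt (M : Kripke) (S : Set (Set M.W)) : Kripke where
  W := Quotient (std M S)
  nomI a := Quotient.mk (std M S) (M.nomI a)
  prpI p := {q | ∃ x, Quotient.mk (std M S) x = q ∧ x ∈ M.prpI p}
  progI σ := {q | ∃ x y, Quotient.mk (std M S) x = q.1 ∧ Quotient.mk (std M S) y = q.2 ∧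
    (x, y) ∈ M.progI σ}

/-- The projection to the filtration. -/
def pr (M : Kripke) (S : Set (Set M.W)) (x : M.W) : (filt M S).W := Quotient.mk (std M S) x

theorem pr_surj (M : Kripke) (S : Set (Set M.W)) (q : (filt M S).W) : ∃ x, pr M S x = q :=
  Quotient.exists_rep q

theorem pr_eq {M : Kripke} {S : Set (Set M.W)} {x y : M.W} (h : pr M S x = pr M S y) :
    ∀ s ∈ S, x ∈ s ↔ y ∈ s := Quotient.exact (s := std M S) h

theorem filt_finite (M : Kripke) (S : Set (Set M.W)) (hS : S.Finite) : Finite (filt M S).W := by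
  have := hS.to_subtype
  let f : (filt M S).W → Set S := fun q => Quotient.lift (s := std M S)
    (fun x => {s : S | x ∈ s.1}) (fun a b h => by ext s; exact h s.1 s.2) q
  refine Finite.of_injective f ?_
  intro a b h
  obtain ⟨x, rfl⟩ := pr_surj M S a
  obtain ⟨y, rfl⟩ := pr_surj M S b
  refine Quotient.sound (s := std M S) fun s hs => ?_
  have := congrArg (fun T : Set S => (⟨s, hs⟩ : S) ∈ T) h
  exact iff_of_eq this

/-- Invariance of a set. -/
def Inv (M : Kripke) (S : Set (Set M.W)) (X : Set M.W) : Prop :=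
  ∀ x y, pr M S x = pr M S y → x ∈ X → y ∈ X

/-- Forward condition. -/
def Fwd (M : Kripke) (S : Set (Set M.W)) (α : Pg) : Prop :=
  ∀ x y, (x, y) ∈ Pg.sem M α → (pr M S x, pr M S y) ∈ Pg.sem (filt M S) α

/-- Backward condition. -/
def Bwd (M : Kripke) (S : Set (Set M.W)) (α : Pg) (X : Set M.W) : Prop :=
  ∀ x y, (pr M S x, pr M S y) ∈ Pg.sem (filt M S) α → y ∈ X → x ∈ Dia M α X

theorem inv_dia {M : Kripke} {S : Set (Set M.W)} {α : Pg} {X : Set M.W}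
    (h1 : Fwd M S α) (h2 : Bwd M S α X) : Inv M S (Dia M α X) := by
  rintro x y hxy ⟨z, hz, hzX⟩
  exact h2 y z (hxy ▸ h1 x z hz) hzX

theorem inv_of {M : Kripke} {S : Set (Set M.W)} {φ : Fm}
    (h : ∀ x, pr M S x ∈ Fm.sem (filt M S) φ ↔ x ∈ Fm.sem M φ) : Inv M S (Fm.sem M φ) :=
  fun x y hxy hx => (h y).1 (hxy ▸ (h x).2 hx)

mutual
theorem mainF (M : Kripke) (S : Set (Set M.W)) : ∀ φ : Fm, C M φ ⊆ S →
    ∀ x, pr M S x ∈ Fm.sem (filt M S) φ ↔ x ∈ Fm.sem M φ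
  | .top, _, x => by simp [Fm.sem]
  | .bot, _, x => by simp [Fm.sem]
  | .prp p, h, x => by
    simp only [Fm.sem]
    constructor
    · rintro ⟨y, hy, hp⟩
      exact (pr_eq (S := S) hy _ (h (by simp [C]))).1 hp
    · intro hx
      exact ⟨x, rfl, hx⟩
  | .nom a, h, x => by
    simp only [Fm.sem]
    constructor
    · intro hy
      exact (pr_eq (S := S) (x := x) (y := M.nomI a) hy _ (h (by simp [C]))).2 rfl
    · intro hx
      have hx : x = M.nomI a := hx
      subst hx
      exact rfl
  | .neg φ, h, x => by
    rw [C] at h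
    simp only [Fm.sem, Set.mem_compl_iff, mainF M S φ h x]
  | .land φ ψ, h, x => by
    rw [C, Set.union_subset_iff] at h
    simp only [Fm.sem, Set.mem_inter_iff, mainF M S φ h.1 x, mainF M S ψ h.2 x]
  | .lor φ ψ, h, x => by
    rw [C, Set.union_subset_iff] at h
    simp only [Fm.sem, Set.mem_union, mainF M S φ h.1 x, mainF M S ψ h.2 x]
  | .imp φ ψ, h, x => by
    rw [C, Set.union_subset_iff] at h
    simp only [Fm.sem, Set.mem_union, Set.mem_compl_iff, mainF M S φ h.1 x, mainF M S ψ h.2 x]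
  | .dia α φ, h, x => by
    rw [C, Set.union_subset_iff] at h
    have hφ := mainF M S φ h.1
    obtain ⟨h1, h2⟩ := mainP M S α _ h.2
    simp only [Fm.sem, Set.mem_ofPred_eq]
    constructor
    · rintro ⟨q, hq, hqφ⟩
      obtain ⟨y, rfl⟩ := pr_surj M S q
      exact h2 (inv_of hφ) x y hq ((hφ y).1 hqφ)
    · rintro ⟨y, hy, hyφ⟩
      exact ⟨_, h1 x y hy, (hφ y).2 hyφ⟩
  | .box α φ, h, x => by
    rw [C, Set.union_subset_iff] at h
    have hφ := mainF M S φ h.1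
    obtain ⟨h1, h2⟩ := mainP M S α _ h.2
    have hinv : Inv M S (Fm.sem M φ)ᶜ := fun a b hab ha hb => ha (inv_of hφ b a hab.symm hb)
    simp only [Fm.sem, Set.mem_ofPred_eq]
    constructor
    · intro H y hy
      exact (hφ y).1 (H _ (h1 x y hy))
    · intro H q hq
      obtain ⟨y, rfl⟩ := pr_surj M S q
      by_contra hc
      obtain ⟨z, hz, hzφ⟩ := h2 hinv x y hq (fun hy => hc ((hφ y).2 hy))
      exact hzφ (H z hz)
theorem mainP (M : Kripke) (S : Set (Set M.W)) : ∀ (α : Pg) (X : Set M.W), P M α X ⊆ S →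
    Fwd M S α ∧ (Inv M S X → Bwd M S α X)
  | .atom σ, X, h => by
    rw [P, Set.singleton_subset_iff] at h
    refine ⟨fun x y hxy => ?_, fun hX x y hxy hy => ?_⟩
    · rw [Pg.sem] at hxy ⊢
      exact ⟨x, y, rfl, rfl, hxy⟩
    · rw [Pg.sem] at hxy
      obtain ⟨x', y', hx, hy', hσ⟩ := hxy
      refine (pr_eq (S := S) hx _ h).1 ⟨y', ?_, hX y y' hy'.symm hy⟩
      rw [Pg.sem]; exact hσ
  | .seq α β, X, h => by
    rw [P, Set.union_subset_iff] at h
    obtain ⟨a1, a2⟩ := mainP M S α _ h.1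
    obtain ⟨b1, b2⟩ := mainP M S β _ h.2
    refine ⟨fun x y hxy => ?_, fun hX x y hxy hy => ?_⟩
    · rw [Pg.sem] at hxy ⊢
      obtain ⟨z, hz, hz'⟩ := hxy
      exact ⟨_, a1 _ _ hz, b1 _ _ hz'⟩
    · rw [Pg.sem] at hxy
      obtain ⟨q, hz, hz'⟩ := hxy
      obtain ⟨z, rfl⟩ := pr_surj M S q
      obtain ⟨u, hu, v, hv, hvX⟩ := a2 (inv_dia b1 (b2 hX)) x z hz (b2 hX z y hz' hy)
      refine ⟨v, ?_, hvX⟩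
      rw [Pg.sem]
      exact ⟨u, hu, hv⟩
  | .choice α β, X, h => by
    rw [P, Set.union_subset_iff] at h
    obtain ⟨a1, a2⟩ := mainP M S α _ h.1
    obtain ⟨b1, b2⟩ := mainP M S β _ h.2
    refine ⟨fun x y hxy => ?_, fun hX x y hxy hy => ?_⟩
    · rw [Pg.sem] at hxy ⊢
      exact hxy.imp (a1 _ _) (b1 _ _)
    · rw [Pg.sem] at hxy
      rcases hxy with hxy | hxy
      · obtain ⟨v, hv, hvX⟩ := a2 hX x y hxy hy
        exact ⟨v, by rw [Pg.sem]; exact Or.inl hv, hvX⟩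
      · obtain ⟨v, hv, hvX⟩ := b2 hX x y hxy hy
        exact ⟨v, by rw [Pg.sem]; exact Or.inr hv, hvX⟩
  | .star α, X, h => by
    rw [P, Set.union_subset_iff, Set.singleton_subset_iff] at h
    obtain ⟨a1, a2⟩ := mainP M S α _ h.2
    have hinv : Inv M S (Dia M (.star α) X) := fun x y hxy hx => (pr_eq hxy _ h.1).1 hx
    refine ⟨fun x y hxy => ?_, fun hX x y hxy hy => ?_⟩
    · rw [Pg.sem] at hxy ⊢
      have key : ∀ y, Relation.ReflTransGen (fun x y => (x, y) ∈ Pg.sem M α) x y →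
          Relation.ReflTransGen (fun x y => (x, y) ∈ Pg.sem (filt M S) α)
            (pr M S x) (pr M S y) := by
        intro y h
        induction h with
        | refl => exact Relation.ReflTransGen.refl
        | tail _ hbc ih => exact Relation.ReflTransGen.tail ih (a1 _ _ hbc)
      exact key y hxy
    · rw [Pg.sem] at hxy
      have key : ∀ q, Relation.ReflTransGen
          (fun x y => (x, y) ∈ Pg.sem (filt M S) α) q (pr M S y) →
          ∀ x, pr M S x = q → x ∈ Dia M (.star α) X := by
        intro q hq
        induction hq using Relation.ReflTransGen.head_induction_on with
        | refl =>
          intro x hx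
          refine ⟨x, ?_, hX y x hx.symm hy⟩
          rw [Pg.sem]
          exact Relation.ReflTransGen.refl
        | @head a c hab _ ih =>
          intro x hx
          subst hx
          obtain ⟨z, rfl⟩ := pr_surj M S c
          obtain ⟨u, hu, v, hv, hvX⟩ := a2 hinv x z hab (ih z rfl)
          refine ⟨v, ?_, hvX⟩
          rw [Pg.sem] at hv ⊢
          exact Relation.ReflTransGen.head hu hv
      exact key _ hxy x rfl
  | .test φ, X, h => by
    rw [P] at h
    have hφ := mainF M S φ h
    refine ⟨fun x y hxy => ?_, fun hX x y hxy hy => ?_⟩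
    · rw [Pg.sem] at hxy ⊢
      obtain ⟨h1, h2⟩ := hxy
      exact ⟨congrArg (pr M S) h1, (hφ x).2 h2⟩
    · rw [Pg.sem] at hxy
      obtain ⟨h1, h2⟩ := hxy
      refine ⟨x, ?_, hX y x h1.symm hy⟩
      rw [Pg.sem]
      exact ⟨rfl, (hφ x).1 h2⟩
end

/-- Closure of an assertion. -/
def CA (M : Kripke) : Assertion → Set (Set M.W)
  | .mem _ φ => C M φ
  | .rel _ _ _ => ∅

theorem CA_finite (M : Kripke) (ξ : Assertion) : (CA M ξ).Finite := by
  cases ξ with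
  | mem a φ => exact C_finite M φ
  | rel σ a b => exact Set.finite_empty

end Filt

/-- If an ABox in HPDL is satisfiable, then it has a finitely branching Kripke
model: a model `M` in which, for every state `x ∈ Δ^M` and every atomic
program `σ`, the set `{y : (x,y) ∈ σ^M}` is finite. -/
theorem satisfiable_has_finitely_branching_model
    (Γ : Finset Assertion) (h : ABoxSat Γ) :
    ∃ M : Kripke, (∀ ξ ∈ Γ, M.satisfies ξ) ∧
      ∀ (x : M.W) (σ : APg), {y : M.W | (x, y) ∈ M.progI σ}.Finite := by
  obtain ⟨M, hM⟩ := h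
  let S : Set (Set M.W) := ⋃ ξ ∈ Γ, Filt.CA M ξ
  have hS : S.Finite := Γ.finite_toSet.biUnion fun ξ _ => Filt.CA_finite M ξ
  have hfin := Filt.filt_finite M S hS
  refine ⟨Filt.filt M S, fun ξ hξ => ?_, fun x σ => Set.toFinite _⟩
  have hsub : Filt.CA M ξ ⊆ S := Set.subset_biUnion_of_mem (u := fun ξ => Filt.CA M ξ) hξ
  have hsat := hM ξ hξ
  cases ξ with
  | mem a φ => exact (Filt.mainF M S φ hsub (M.nomI a)).2 hsat
  | rel σ a b => exact ⟨_, _, rfl, rfl, hsat⟩
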